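/- The integral ∫₀^∞ (1/(x+1))·(2·Li₂(−x) + (1/2)log²(x) + ζ(2)) dx + ∫₀^∞ (1/x)·(−Li₂(−x) + log²(x+1) − log(x)·log(x+1)) dx converges and equals 6ζ(3). -/

import Mathlib

open MeasureTheory Real intervalIntegral

/-- `Li₂(−x) = −∫₀^x log(1+t)/t dt` for `x > 0`. -/
noncomputable def dilogNeg (x : ℝ) : ℝ := -∫ t in (0 : ℝ)..x, Real.log (1 + t) / t

open Filter Topology

/-- The polylogarithm `Li_s(u)` as a power series. -/
noncomputable def polyLi (s : ℕ) (u : ℝ) : ℝ := ∑' n : ℕ, u ^ (n + 1) / ((n : ℝ) + 1) ^ s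

lemma summable_shift {s : ℕ} (hs : 2 ≤ s) : Summable fun n : ℕ => 1 / ((n : ℝ) + 1) ^ s := by
  have := (summable_nat_add_iff 1).2 (Real.summable_one_div_nat_pow (p := s) |>.2 (by omega))
  simpa using this

lemma polyLi_term_le {s : ℕ} {u : ℝ} (hu : |u| ≤ 1) (n : ℕ) :
    ‖u ^ (n + 1) / ((n : ℝ) + 1) ^ s‖ ≤ 1 / ((n : ℝ) + 1) ^ s := by
  have h0 : (0 : ℝ) < ((n : ℝ) + 1) ^ s := by positivity
  rw [norm_div, norm_pow, Real.norm_eq_abs, Real.norm_of_nonneg h0.le]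
  gcongr
  exact pow_le_one₀ (abs_nonneg _) hu

lemma polyLi_summable {s : ℕ} (hs : 2 ≤ s) {u : ℝ} (hu : |u| ≤ 1) :
    Summable fun n : ℕ => u ^ (n + 1) / ((n : ℝ) + 1) ^ s :=
  Summable.of_norm_bounded (summable_shift hs) (polyLi_term_le hu)

lemma polyLi_continuousOn {s : ℕ} (hs : 2 ≤ s) : ContinuousOn (polyLi s) (Set.Icc (-1) 1) := by
  apply continuousOn_tsum (fun i => by fun_prop) (summable_shift hs)
  intro n x hx
  exact polyLi_term_le (abs_le.2 hx) n

lemma polyLi_hasDerivAt (s : ℕ) {u : ℝ} (hu : |u| < 1) (h0 : u ≠ 0) :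
    HasDerivAt (polyLi (s + 1)) (polyLi s u / u) u := by
  obtain ⟨r, hr1, hr2⟩ := exists_between hu
  have hr0 : 0 ≤ r := (abs_nonneg u).trans hr1.le
  have key := hasDerivAt_tsum_of_isPreconnected (𝕜 := ℝ)
    (g := fun (n : ℕ) (z : ℝ) => z ^ (n + 1) / ((n : ℝ) + 1) ^ (s + 1))
    (g' := fun (n : ℕ) (z : ℝ) => z ^ n / ((n : ℝ) + 1) ^ s)
    (u := fun n => r ^ n) (t := Set.Ioo (-r) r) (y₀ := 0) (y := u)
    (summable_geometric_of_lt_one hr0 hr2) isOpen_Ioo isPreconnected_Ioo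
    (by
      intro n y _
      have := (hasDerivAt_pow (n + 1) y).div_const (((n : ℝ) + 1) ^ (s + 1))
      refine this.congr_deriv ?_
      have : ((n : ℝ) + 1) ≠ 0 := by positivity
      push_cast
      field_simp
      ring)
    (by
      intro n y hy
      have h0 : (1 : ℝ) ≤ ((n : ℝ) + 1) ^ s := one_le_pow₀ (by linarith [Nat.cast_nonneg (α := ℝ) n])
      rw [norm_div, norm_pow, Real.norm_eq_abs, Real.norm_of_nonneg (by linarith)]
      calc |y| ^ n / ((n : ℝ) + 1) ^ s ≤ |y| ^ n := div_le_self (by positivity) h0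
        _ ≤ r ^ n := by
          gcongr
          exact (abs_lt.2 hy).le)
    (by constructor <;> linarith [abs_pos.2 h0])
    (by simp)
    (abs_lt.1 hr1)
  refine key.congr_deriv ?_
  rw [polyLi, ← tsum_div_const]
  congr 1
  ext n
  field_simp
  ring

lemma polyLi_one {u : ℝ} (hu : |u| < 1) : polyLi 1 u = -log (1 - u) := by
  have := (hasSum_pow_div_log_of_abs_lt_one hu).tsum_eq
  simpa [polyLi] using this

lemma polyLi_zero (s : ℕ) : polyLi s 0 = 0 := by simp [polyLi]

lemma polyLi_two_one : polyLi 2 1 = π ^ 2 / 6 := by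
  have := hasSum_zeta_two
  rw [← hasSum_nat_add_iff' 1] at this
  simpa [polyLi] using this.tsum_eq

lemma polyLi_two_neg_one : polyLi 2 (-1) = -(π ^ 2 / 12) := by
  have h1 := (polyLi_summable (s := 2) le_rfl (u := 1) (by simp)).hasSum
  have h2 := (polyLi_summable (s := 2) le_rfl (u := -1) (by simp)).hasSum
  have h3 := h1.add h2
  have e1 : (∑' n : ℕ, (1:ℝ) ^ (n + 1) / ((n : ℝ) + 1) ^ 2) = π ^ 2 / 6 := polyLi_two_one
  have h4 : HasSum (fun n : ℕ => (1:ℝ) ^ (n + 1) / ((n : ℝ) + 1) ^ 2 +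
      (-1 : ℝ) ^ (n + 1) / ((n : ℝ) + 1) ^ 2) (0 + 1 / 2 * (π ^ 2 / 6)) := by
    apply HasSum.even_add_odd
    · convert! hasSum_zero with k
      simp [pow_succ, pow_mul]
      field_simp
      ring
    · rw [← e1]
      convert! h1.mul_left (1 / 2) using 2 with k
      have : ((k : ℝ) + 1) ≠ 0 := by positivity
      have e : (2 * (k:ℝ) + 1 + 1) ≠ 0 := by positivity
      push_cast
      simp [pow_succ, pow_mul]
      field_simp
      ring
  have := h3.unique h4
  rw [e1] at this
  rw [polyLi]
  linarith

/-! the dilogarithm -/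

lemma q_bound {t : ℝ} (ht : 0 < t) : ‖Real.log (1 + t) / t‖ ≤ 1 := by
  have h1 : 0 ≤ Real.log (1 + t) := Real.log_nonneg (by linarith)
  have h2 : Real.log (1 + t) ≤ t := by
    have := Real.log_le_sub_one_of_pos (x := 1 + t) (by linarith)
    linarith
  rw [Real.norm_of_nonneg (by positivity)]
  exact (div_le_one ht).2 h2

lemma q_meas : Measurable fun t : ℝ => Real.log (1 + t) / t := by fun_prop

lemma q_int {x : ℝ} (hx : 0 ≤ x) :
    IntervalIntegrable (fun t : ℝ => Real.log (1 + t) / t) volume 0 x := by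
  refine (intervalIntegrable_const (c := (1 : ℝ))).mono_fun q_meas.aestronglyMeasurable ?_
  rw [Set.uIoc_of_le hx]
  refine (ae_restrict_iff' measurableSet_Ioc).2 (Eventually.of_forall fun t ht => ?_)
  simpa using q_bound ht.1

lemma D_hasDerivAt {x : ℝ} (hx : 0 < x) : HasDerivAt dilogNeg (-(Real.log (1 + x) / x)) x := by
  refine (intervalIntegral.integral_hasDerivAt_right (q_int hx.le)
    q_meas.stronglyMeasurable.stronglyMeasurableAtFilter ?_).neg
  refine ContinuousAt.div (ContinuousAt.log (by fun_prop) (by linarith)) continuousAt_id hx.ne'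

lemma D_abs {x : ℝ} (hx : 0 ≤ x) : |dilogNeg x| ≤ x := by
  have := intervalIntegral.norm_integral_le_of_norm_le_const (a := 0) (b := x) (C := 1)
    (f := fun t : ℝ => Real.log (1 + t) / t) (by
      intro t ht
      rw [Set.uIoc_of_le hx] at ht
      exact q_bound ht.1)
  rw [dilogNeg, abs_neg]
  simpa [abs_of_nonneg hx] using this

lemma D_nonpos {x : ℝ} (hx : 0 ≤ x) : dilogNeg x ≤ 0 := by
  rw [dilogNeg, neg_nonpos]
  apply intervalIntegral.integral_nonneg hx
  intro t ht
  exact div_nonneg (Real.log_nonneg (by linarith [ht.1])) ht.1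

lemma D_zero : dilogNeg 0 = 0 := by simp [dilogNeg]

lemma D_tendsto_zero : Tendsto dilogNeg (𝓝[≥] 0) (𝓝 0) := by
  have h : Tendsto (fun x : ℝ => x) (𝓝[≥] 0) (𝓝 0) := tendsto_id.mono_left nhdsWithin_le_nhds
  refine squeeze_zero_norm' ?_ h
  filter_upwards [self_mem_nhdsWithin] with x hx
  exact D_abs hx

lemma D_one : dilogNeg 1 = -(π ^ 2 / 12) := by
  obtain ⟨c, hc, h⟩ := exists_hasDerivAt_eq_slope (fun x => dilogNeg x - polyLi 2 (-x)) (fun _ => 0)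
    (zero_lt_one) (by
      apply ContinuousOn.sub
      · intro x hx
        rcases hx.1.eq_or_lt with rfl | h
        · have : ContinuousWithinAt dilogNeg (Set.Ici 0) 0 := by
            simpa only [ContinuousWithinAt, D_zero] using D_tendsto_zero
          exact this.mono Set.Icc_subset_Ici_self
        · exact (D_hasDerivAt h).continuousAt.continuousWithinAt
      · apply (polyLi_continuousOn le_rfl).comp (by fun_prop)
        intro x hx
        constructor <;> linarith [hx.1, hx.2]) (by
      intro x hx
      have hx' : |-x| < 1 := by rw [abs_neg, abs_of_pos hx.1]; exact hx.2
      have h1 := (polyLi_hasDerivAt 1 hx' (by linarith [hx.1])).comp x (hasDerivAt_neg x)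
      have h2 := (D_hasDerivAt hx.1).sub h1
      refine h2.congr_deriv ?_
      rw [polyLi_one hx']
      have := hx.1.ne'
      field_simp
      ring_nf)
  simp [D_zero, polyLi_zero, polyLi_two_neg_one] at h
  linarith

lemma N_eq {x : ℝ} (hx : 0 < x) : log (1 + x⁻¹) = log (1 + x) - log x := by
  rw [← Real.log_div (by linarith) hx.ne']
  congr 1
  field_simp
  ring

lemma Dinv_hasDerivAt {x : ℝ} (hx : 0 < x) :
    HasDerivAt (fun x => dilogNeg x⁻¹) (log (1 + x⁻¹) / x) x := by
  have := (D_hasDerivAt (inv_pos.2 hx)).comp x (hasDerivAt_inv hx.ne')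
  refine this.congr_deriv ?_
  field_simp

lemma D_inversion {x : ℝ} (hx : 0 < x) :
    dilogNeg x + dilogNeg x⁻¹ + log x ^ 2 / 2 = -(π ^ 2 / 6) := by
  have hd : ∀ x ∈ Set.Ioi (0:ℝ), HasDerivAt
      (fun x => dilogNeg x + dilogNeg x⁻¹ + log x ^ 2 / 2) 0 x := by
    intro x hx
    have hx : 0 < x := hx
    have := ((D_hasDerivAt hx).add (Dinv_hasDerivAt hx)).add
      (((Real.hasDerivAt_log hx.ne').pow 2).div_const 2)
    refine this.congr_deriv ?_
    rw [N_eq hx]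
    simp
    field_simp
    ring
  have := IsOpen.is_const_of_deriv_eq_zero (𝕜 := ℝ) isOpen_Ioi isPreconnected_Ioi
    (fun x hx => (hd x hx).differentiableAt.differentiableWithinAt)
    (fun x hx => (hd x hx).deriv) (Set.mem_Ioi.2 hx) (Set.mem_Ioi.2 one_pos)
  refine this.trans ?_
  rw [inv_one, D_one, log_one]
  ring

/-! the auxiliary function `P` -/

/-- `Li₃(u) − log u · Li₂(u)`. -/
noncomputable def auxP (u : ℝ) : ℝ := polyLi 3 u - log u * polyLi 2 u

lemma auxP_hasDerivAt {u : ℝ} (h0 : 0 < u) (h1 : u < 1) :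
    HasDerivAt auxP (log u * log (1 - u) / u) u := by
  have hu : |u| < 1 := by rwa [abs_of_pos h0]
  have := (polyLi_hasDerivAt 2 hu h0.ne').sub
    ((Real.hasDerivAt_log h0.ne').mul (polyLi_hasDerivAt 1 hu h0.ne'))
  refine this.congr_deriv ?_
  rw [polyLi_one hu]
  field_simp
  ring

lemma polyLi_bound {u : ℝ} (h0 : 0 ≤ u) (h1 : u ≤ 1) : |polyLi 2 u| ≤ u * polyLi 2 1 := by
  rw [polyLi, polyLi, ← tsum_mul_left, ← Real.norm_eq_abs]
  apply tsum_of_norm_bounded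
    ((polyLi_summable le_rfl (u := 1) (by simp)).mul_left u).hasSum
  intro n
  have hp : (0 : ℝ) < ((n : ℝ) + 1) ^ 2 := by positivity
  rw [Real.norm_of_nonneg (by positivity), one_pow, mul_one_div]
  gcongr
  rw [pow_succ]
  exact mul_le_of_le_one_left h0 (pow_le_one₀ h0 h1)

lemma auxP_tendsto_zero : Tendsto auxP (𝓝[>] 0) (𝓝 0) := by
  have hev : ∀ᶠ u in 𝓝[>] (0:ℝ), 0 < u ∧ u < 1 := by
    filter_upwards [Ioo_mem_nhdsGT (zero_lt_one (α := ℝ))] with u hu using hu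
  have hle : 𝓝[>] (0:ℝ) ≤ 𝓝[Set.Icc (-1) 1] 0 := by
    rw [nhdsWithin_eq_nhds.2 (Icc_mem_nhds (by norm_num) (by norm_num))]
    exact nhdsWithin_le_nhds
  have h3 : Tendsto (polyLi 3) (𝓝[>] 0) (𝓝 0) := by
    have := polyLi_continuousOn (s := 3) (by norm_num) 0 (by norm_num)
    rw [ContinuousWithinAt, polyLi_zero] at this
    exact this.mono_left hle
  have h2 : Tendsto (fun u => log u * polyLi 2 u) (𝓝[>] 0) (𝓝 0) := by
    have hl : Tendsto (fun u : ℝ => |log u * u ^ (1:ℝ)| * polyLi 2 1) (𝓝[>] 0) (𝓝 0) := by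
      simpa using (tendsto_log_mul_rpow_nhdsGT_zero (r := 1) one_pos).abs.mul_const (polyLi 2 1)
    refine squeeze_zero_norm' ?_ hl
    filter_upwards [hev] with u hu
    rw [norm_mul, rpow_one, abs_mul, abs_of_pos hu.1, mul_assoc, Real.norm_eq_abs, Real.norm_eq_abs]
    gcongr
    exact polyLi_bound hu.1.le hu.2.le
  have := h3.sub h2
  rw [sub_zero] at this
  exact this

lemma auxP_tendsto_one : Tendsto auxP (𝓝[<] 1) (𝓝 (polyLi 3 1)) := by
  have hc : ContinuousWithinAt auxP (Set.Icc 0 1) 1 := by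
    have hsub : Set.Icc (0:ℝ) 1 ⊆ Set.Icc (-1) 1 := Set.Icc_subset_Icc (by norm_num) le_rfl
    refine ContinuousWithinAt.sub ?_ (ContinuousWithinAt.mul ?_ ?_)
    · exact (polyLi_continuousOn (by norm_num) 1 (by norm_num)).mono hsub
    · exact (Real.continuousAt_log one_ne_zero).continuousWithinAt
    · exact (polyLi_continuousOn (by norm_num) 1 (by norm_num)).mono hsub
  have h1 : auxP 1 = polyLi 3 1 := by simp [auxP]
  rw [ContinuousWithinAt, h1] at hc
  refine hc.mono_left ?_
  apply nhdsWithin_le_of_mem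
  filter_upwards [Ioo_mem_nhdsLT (zero_lt_one (α := ℝ))] with u hu using Set.Ioo_subset_Icc_self hu

/-- Half of the antiderivative. -/
noncomputable def auxA (x : ℝ) : ℝ := dilogNeg x * log (1 + x⁻¹) - 3 * auxP (1 + x)⁻¹

/-- The derivative of `auxA`. -/
noncomputable def auxA' (x : ℝ) : ℝ :=
  -(log (1 + x) * log (1 + x⁻¹) / x) - dilogNeg x / (x * (x + 1)) +
    3 * (log (1 + x) * log (1 + x⁻¹)) / (1 + x)

lemma auxA_hasDerivAt {x : ℝ} (hx : 0 < x) : HasDerivAt auxA (auxA' x) x := by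
  have hx1 : 0 < 1 + x := by linarith
  have hi : 0 < x⁻¹ := inv_pos.2 hx
  have hN : HasDerivAt (fun x : ℝ => log (1 + x⁻¹)) (-(x ^ 2)⁻¹ / (1 + x⁻¹)) x :=
    ((hasDerivAt_inv hx.ne').const_add 1).log (by positivity)
  have hv : HasDerivAt (fun x : ℝ => (1 + x)⁻¹) (-1 / (1 + x) ^ 2) x :=
    ((hasDerivAt_id x).const_add 1).fun_inv hx1.ne'
  have hP := (auxP_hasDerivAt (u := (1 + x)⁻¹) (by positivity)
    (inv_lt_one_of_one_lt₀ (by linarith))).comp x hv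
  have := ((D_hasDerivAt hx).mul hN).sub (hP.const_mul 3)
  refine this.congr_deriv ?_
  have e1 : log (1 - (1 + x)⁻¹) = -log (1 + x⁻¹) := by
    rw [← Real.log_inv]
    congr 1
    field_simp
    ring
  rw [e1, Real.log_inv, auxA']
  generalize log (1 + x⁻¹) = N
  field_simp
  ring

lemma D_mul_N_zero : Tendsto (fun x => dilogNeg x * log (1 + x⁻¹)) (𝓝[>] 0) (𝓝 0) := by
  have h1 : Tendsto (fun x : ℝ => log (1 + x) * x - log x * x ^ (1:ℝ)) (𝓝[>] 0) (𝓝 0) := by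
    have a : Tendsto (fun x : ℝ => log (1 + x) * x) (𝓝[>] 0) (𝓝 0) := by
      have : ContinuousAt (fun x : ℝ => log (1 + x) * x) 0 :=
        (ContinuousAt.log (by fun_prop) (by norm_num)).mul continuousAt_id
      rw [ContinuousAt] at this
      simp only [mul_zero] at this
      exact this.mono_left nhdsWithin_le_nhds
    simpa using a.sub (tendsto_log_mul_rpow_nhdsGT_zero (r := 1) one_pos)
  refine squeeze_zero_norm' ?_ h1
  filter_upwards [self_mem_nhdsWithin] with x hx
  have hx : 0 < x := hx
  have hN : 0 ≤ log (1 + x⁻¹) := Real.log_nonneg (by linarith [inv_pos.2 hx])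
  rw [norm_mul, Real.norm_of_nonneg hN, rpow_one, ← sub_mul, ← N_eq hx, mul_comm]
  gcongr
  exact D_abs hx.le

lemma D_mul_N_top : Tendsto (fun x => dilogNeg x * log (1 + x⁻¹)) atTop (𝓝 0) := by
  have h1 : Tendsto (fun x : ℝ => (x⁻¹ + π ^ 2 / 6) * x⁻¹ + log x ^ 2 / x / 2) atTop (𝓝 0) := by
    have a : Tendsto (fun x : ℝ => log x ^ 2 / x) atTop (𝓝 0) :=
      (isLittleO_pow_log_id_atTop (n := 2)).tendsto_div_nhds_zero
    have b : Tendsto (fun x : ℝ => x⁻¹) atTop (𝓝 0) := tendsto_inv_atTop_zero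
    simpa using ((b.add_const (π ^ 2 / 6)).mul b).add (a.div_const 2)
  refine squeeze_zero_norm' ?_ h1
  filter_upwards [eventually_gt_atTop 0] with x hx
  have hi : 0 < x⁻¹ := inv_pos.2 hx
  have hN : 0 ≤ log (1 + x⁻¹) := Real.log_nonneg (by linarith)
  have hN' : log (1 + x⁻¹) ≤ x⁻¹ := by
    linarith [Real.log_le_sub_one_of_pos (x := 1 + x⁻¹) (by linarith)]
  have hD := D_inversion hx
  have hDi := abs_le.1 (D_abs hi.le)
  have hn := D_nonpos hi.le
  have hD' : ‖dilogNeg x‖ ≤ x⁻¹ + π ^ 2 / 6 + log x ^ 2 / 2 := by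
    rw [Real.norm_of_nonpos (D_nonpos hx.le)]
    linarith
  calc ‖dilogNeg x * log (1 + x⁻¹)‖ = ‖dilogNeg x‖ * log (1 + x⁻¹) := by
        rw [norm_mul, Real.norm_of_nonneg hN]
    _ ≤ (x⁻¹ + π ^ 2 / 6 + log x ^ 2 / 2) * x⁻¹ := by gcongr
    _ = _ := by ring

lemma auxA_zero : Tendsto auxA (𝓝[>] 0) (𝓝 (-3 * polyLi 3 1)) := by
  have hv : Tendsto (fun x : ℝ => (1 + x)⁻¹) (𝓝[>] 0) (𝓝[<] 1) := by
    apply tendsto_nhdsWithin_of_tendsto_nhds_of_eventually_within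
    · have : ContinuousAt (fun x : ℝ => (1 + x)⁻¹) 0 :=
        ContinuousAt.inv₀ (by fun_prop) (by norm_num)
      rw [ContinuousAt] at this
      simp only [add_zero, inv_one] at this
      exact this.mono_left nhdsWithin_le_nhds
    · filter_upwards [self_mem_nhdsWithin] with x hx
      have hx : 0 < x := hx
      have hx1 : 1 < 1 + x := by linarith
      exact inv_lt_one_of_one_lt₀ hx1
  have := D_mul_N_zero.sub ((auxP_tendsto_one.comp hv).const_mul 3)
  rw [zero_sub, ← neg_mul] at this
  exact this

lemma auxA_top : Tendsto auxA atTop (𝓝 0) := by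
  have hv : Tendsto (fun x : ℝ => (1 + x)⁻¹) atTop (𝓝[>] 0) :=
    tendsto_inv_atTop_nhdsGT_zero.comp (tendsto_atTop_add_const_left _ _ tendsto_id)
  have := D_mul_N_top.sub ((auxP_tendsto_zero.comp hv).const_mul 3)
  rw [mul_zero, sub_zero] at this
  exact this

/-- The antiderivative on `[0, ∞)`. -/
noncomputable def auxF (x : ℝ) : ℝ := if x = 0 then -3 * polyLi 3 1 else auxA x - auxA x⁻¹

lemma auxF_hasDerivAt {x : ℝ} (hx : 0 < x) :
    HasDerivAt auxF (-dilogNeg x / (x * (x + 1)) - dilogNeg x⁻¹ / (x + 1) +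
      log (1 + x) * log (1 + x⁻¹) / x) x := by
  have hi : 0 < x⁻¹ := inv_pos.2 hx
  have h := (auxA_hasDerivAt hx).sub ((auxA_hasDerivAt hi).comp x (hasDerivAt_inv hx.ne'))
  have h' := h.congr_of_eventuallyEq (f₁ := auxF) (by
    filter_upwards [lt_mem_nhds hx] with y hy
    simp [auxF, hy.ne'])
  refine h'.congr_deriv ?_
  rw [auxA', auxA', inv_inv]
  generalize log (1 + x⁻¹) = N
  generalize dilogNeg x⁻¹ = D'
  field_simp
  ring

lemma auxF_cont : ContinuousWithinAt auxF (Set.Ici 0) 0 := by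
  rw [← continuousWithinAt_Ioi_iff_Ici, ContinuousWithinAt]
  have h := auxA_zero.sub (auxA_top.comp tendsto_inv_nhdsGT_zero)
  rw [sub_zero] at h
  have e : auxF 0 = -3 * polyLi 3 1 := by simp [auxF]
  rw [e]
  refine h.congr' ?_
  filter_upwards [self_mem_nhdsWithin] with x hx
  have hx : 0 < x := hx
  simp [auxF, hx.ne']

lemma auxF_top : Tendsto auxF atTop (𝓝 (3 * polyLi 3 1)) := by
  have h := auxA_top.sub (auxA_zero.comp tendsto_inv_atTop_nhdsGT_zero)
  rw [zero_sub, neg_mul, neg_neg] at h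
  refine h.congr' ?_
  filter_upwards [eventually_gt_atTop 0] with x hx
  simp [auxF, hx.ne']

lemma integrand_eq {x : ℝ} (hx : 0 < x) :
    (1 / (x + 1)) * (2 * dilogNeg x + (1 / 2) * Real.log x ^ 2 + π ^ 2 / 6) +
      (1 / x) * (-dilogNeg x + Real.log (x + 1) ^ 2 - Real.log x * Real.log (x + 1)) =
    -dilogNeg x / (x * (x + 1)) - dilogNeg x⁻¹ / (x + 1) +
      log (1 + x) * log (1 + x⁻¹) / x := by
  have h := D_inversion hx
  have h' : π ^ 2 / 6 = -(dilogNeg x + dilogNeg x⁻¹ + log x ^ 2 / 2) := by linarith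
  rw [h', N_eq hx, add_comm 1 x]
  generalize dilogNeg x⁻¹ = D'
  field_simp
  ring

theorem wheel_three_spokes_period :
    IntegrableOn
      (fun x : ℝ =>
        (1 / (x + 1)) * (2 * dilogNeg x + (1 / 2) * Real.log x ^ 2 + π ^ 2 / 6) +
          (1 / x) * (-dilogNeg x + Real.log (x + 1) ^ 2 - Real.log x * Real.log (x + 1)))
      (Set.Ioi 0) volume ∧
    ∫ x in Set.Ioi (0 : ℝ),
        ((1 / (x + 1)) * (2 * dilogNeg x + (1 / 2) * Real.log x ^ 2 + π ^ 2 / 6) +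
          (1 / x) * (-dilogNeg x + Real.log (x + 1) ^ 2 - Real.log x * Real.log (x + 1))) =
      6 * ∑' k : ℕ, (1 : ℝ) / ((k : ℝ) + 1) ^ 3 := by
  have hd : ∀ x ∈ Set.Ioi (0:ℝ), HasDerivAt auxF
      ((1 / (x + 1)) * (2 * dilogNeg x + (1 / 2) * Real.log x ^ 2 + π ^ 2 / 6) +
        (1 / x) * (-dilogNeg x + Real.log (x + 1) ^ 2 - Real.log x * Real.log (x + 1))) x := by
    intro x hx
    exact (auxF_hasDerivAt hx).congr_deriv (integrand_eq hx).symm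
  have hp : ∀ x ∈ Set.Ioi (0:ℝ), 0 ≤
      ((1 / (x + 1)) * (2 * dilogNeg x + (1 / 2) * Real.log x ^ 2 + π ^ 2 / 6) +
        (1 / x) * (-dilogNeg x + Real.log (x + 1) ^ 2 - Real.log x * Real.log (x + 1))) := by
    intro x hx
    have hx : 0 < x := hx
    have hi : 0 < x⁻¹ := inv_pos.2 hx
    rw [integrand_eq hx]
    have h1 : 0 ≤ -dilogNeg x / (x * (x + 1)) :=
      div_nonneg (neg_nonneg.2 (D_nonpos hx.le)) (by positivity)
    have h2 : dilogNeg x⁻¹ / (x + 1) ≤ 0 :=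
      div_nonpos_of_nonpos_of_nonneg (D_nonpos hi.le) (by positivity)
    have h3 : 0 ≤ log (1 + x) * log (1 + x⁻¹) / x :=
      div_nonneg (mul_nonneg (Real.log_nonneg (by linarith)) (Real.log_nonneg (by linarith))) hx.le
    linarith
  refine ⟨integrableOn_Ioi_deriv_of_nonneg auxF_cont hd hp auxF_top, ?_⟩
  rw [integral_Ioi_of_hasDerivAt_of_nonneg auxF_cont hd hp auxF_top]
  have e : auxF 0 = -3 * polyLi 3 1 := by simp [auxF]
  have e2 : polyLi 3 1 = ∑' k : ℕ, (1 : ℝ) / ((k : ℝ) + 1) ^ 3 := by simp [polyLi]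
  rw [e, ← e2]
  ring
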